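/- Honest-verifier zero-knowledge simulation of the Chaum–Pedersen protocol: Let q be a prime, let g, h : G satisfy g^q = 1 and h^q = 1, and fix x, e : ZMod q. Then the distribution of real transcripts, obtained by choosing a uniformly in ZMod q and outputting (g^(a.val), h^(a.val), a + e*x), equals the distribution of simulated transcripts, obtained by choosing z uniformly in ZMod q and outputting (g^((z - e*x).val), h^((z - e*x).val), z). Formally: PMF.map (fun a : ZMod q => (g^(a.val), h^(a.val), a + e*x)) (PMF.uniformOfFintype (ZMod q)) = PMF.map (fun z : ZMod q => (g^((z - e*x).val), h^((z - e*x).val), z)) (PMF.uniformOfFintype (ZMod q)). -/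

import Mathlib

/-- The uniform distribution on a finite type is invariant under permutations. -/
theorem PMF.map_equiv_uniformOfFintype {α : Type*} [Fintype α] [Nonempty α] (σ : α ≃ α) :
    PMF.map σ (PMF.uniformOfFintype α) = PMF.uniformOfFintype α := by
  classical
  ext b
  rw [PMF.map_apply, tsum_eq_single (σ.symm b)]
  · simp
  · intro a ha
    exact if_neg fun hb => ha (by simp [hb])

/-- Honest-verifier zero-knowledge simulation of the Chaum–Pedersen protocol:
real transcripts (with uniform prover coin a) are distributed exactly as
simulated transcripts (with uniform response z). -/
theorem chaum_pedersen_hvzk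
    {G : Type*} [CommGroup G] (q : ℕ) (hq : q.Prime) [Fact q.Prime]
    (g h : G) (hg : g ^ q = 1) (hh : h ^ q = 1) (x e : ZMod q) :
    PMF.map (fun a : ZMod q => (g ^ (a.val), h ^ (a.val), a + e * x))
      (PMF.uniformOfFintype (ZMod q)) =
    PMF.map (fun z : ZMod q =>
        (g ^ ((z - e * x).val), h ^ ((z - e * x).val), z))
      (PMF.uniformOfFintype (ZMod q)) := by
  conv_rhs => rw [← PMF.map_equiv_uniformOfFintype (Equiv.addRight (e * x)), PMF.map_comp]
  congr 1
  funext a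
  simp
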